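/- Let n ≥ 1, let α > 0, let x ∈ ℝⁿ with x ≠ 0, and let R ∈ ℝ^{n×n} be a matrix all of whose entries satisfy |R_{ij}| ≤ 1. Define x' = x + (α / (n ‖x‖₂)) · R x (the rotation transformation of the state transition algorithm). Then ‖x' − x‖₂ ≤ α; that is, the rotation transformation moves the current state by a Euclidean distance of at most the rotation factor α. -/

import Mathlib

theorem norm_toLp_mulVec_le_card_mul_norm {ι : Type*} [Fintype ι] (R : Matrix ι ι ℝ)
    (hR : ∀ i j, |R i j| ≤ 1) (x : EuclideanSpace ℝ ι) :
    ‖WithLp.toLp 2 (R.mulVec x)‖ ≤ Fintype.card ι * ‖x‖ := by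
  have hrow (i : ι) : (R.mulVec x i) ^ 2 ≤ Fintype.card ι * ‖x‖ ^ 2 := by
    calc (R.mulVec x i) ^ 2 ≤ (∑ j, R i j ^ 2) * ∑ j, x j ^ 2 :=
          Finset.sum_mul_sq_le_sq_mul_sq Finset.univ (R i) x
      _ ≤ (∑ _j : ι, (1 : ℝ)) * ∑ j, x j ^ 2 := by
          gcongr with j
          exact (sq_le_one_iff_abs_le_one _).2 (hR i j)
      _ = Fintype.card ι * ‖x‖ ^ 2 := by simp [EuclideanSpace.real_norm_sq_eq]
  refine le_of_sq_le_sq ?_ (by positivity)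
  calc ‖WithLp.toLp 2 (R.mulVec x)‖ ^ 2 = ∑ i, (R.mulVec x i) ^ 2 := by
        simp [EuclideanSpace.real_norm_sq_eq]
    _ ≤ ∑ _i : ι, Fintype.card ι * ‖x‖ ^ 2 := Finset.sum_le_sum fun i _ => hrow i
    _ = (Fintype.card ι * ‖x‖) ^ 2 := by
        rw [Finset.sum_const, Finset.card_univ, nsmul_eq_mul]
        ring

/-- The rotation transformation
`x' = x + (α / (n ‖x‖₂)) • R x` (with `α > 0`, `x ≠ 0`, `|R i j| ≤ 1`)
moves the state by Euclidean distance at most `α`. -/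
theorem rotation_transformation_radius (n : ℕ) (hn : 1 ≤ n) (α : ℝ) (hα : 0 < α)
    (x : EuclideanSpace ℝ (Fin n)) (hx : x ≠ 0)
    (R : Matrix (Fin n) (Fin n) ℝ) (hR : ∀ i j, |R i j| ≤ 1)
    (x' : EuclideanSpace ℝ (Fin n))
    (hx' : x' = x + (α / ((n : ℝ) * ‖x‖)) • (WithLp.equiv 2 (Fin n → ℝ)).symm (R.mulVec x)) :
    ‖x' - x‖ ≤ α := by
  have hpos : 0 < (n : ℝ) * ‖x‖ := mul_pos (by exact_mod_cast hn) (norm_pos_iff.2 hx)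
  have hle : ‖(WithLp.equiv 2 (Fin n → ℝ)).symm (R.mulVec x)‖ ≤ n * ‖x‖ := by
    simpa using norm_toLp_mulVec_le_card_mul_norm R hR x
  rw [hx', add_sub_cancel_left, norm_smul, Real.norm_of_nonneg (by positivity)]
  calc α / (n * ‖x‖) * ‖(WithLp.equiv 2 (Fin n → ℝ)).symm (R.mulVec x)‖
      ≤ α / (n * ‖x‖) * (n * ‖x‖) := by gcongr
    _ = α := div_mul_cancel₀ α hpos.ne'
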